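/- arXiv:2507.10138 — 7 statements merged into one kernel-verified Lean document; each statement's English description precedes it below -/
import Mathlib

section
/- Let n ≥ 2 and let A be the n×n real mammillary matrix with parameters k_{10} > 0 and k_{1i} > 0, k_{i1} > 0 for i = 2,…,n, i.e., A has first diagonal entry −k_{10} − Σ_{i=2}^n k_{1i}, first-row entries A_{1i} = k_{i1} for i ≥ 2, first-column entries A_{i1} = k_{1i} for i ≥ 2, diagonal entries A_{ii} = −k_{i1} for i ≥ 2, and all other entries zero. Then every complex eigenvalue λ of A is real and satisfies λ ≤ 0. -/
open Finset Complex

/-- The `(n+2)`-compartment mammillary matrix (so the number of compartments is at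
least 2) with elimination rate `k10` from the central compartment (index `0`), rates
`kin i` (= `k_{i1}`) from peripheral compartment `i` to the central one, and rates
`kout i` (= `k_{1i}`) from the central compartment to peripheral compartment `i`. -/
def mammillary (n : ℕ) (k10 : ℝ) (kin kout : Fin (n + 2) → ℝ) :
    Matrix (Fin (n + 2)) (Fin (n + 2)) ℝ :=
  Matrix.of fun i j =>
    if i = 0 then
      if j = 0 then -k10 - ∑ l ∈ Finset.univ.filter (fun l => l ≠ (0 : Fin (n + 2))), kout l
      else kin j
    else if j = 0 then kout i
    else if i = j then -kin i
    else 0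

/-- with strictly positive parameters, every complex eigenvalue of the
mammillary matrix is real and nonpositive. -/
theorem mammillary_eigenvalue_real_nonpos
    (n : ℕ) (k10 : ℝ) (kin kout : Fin (n + 2) → ℝ)
    (hk10 : 0 < k10)
    (hkin : ∀ i : Fin (n + 2), i ≠ 0 → 0 < kin i)
    (hkout : ∀ i : Fin (n + 2), i ≠ 0 → 0 < kout i)
    (lam : ℂ) (v : Fin (n + 2) → ℂ) (hv : v ≠ 0)
    (heig : ((mammillary n k10 kin kout).map (fun x : ℝ => (x : ℂ))).mulVec v
      = lam • v) :
    lam.im = 0 ∧ lam.re ≤ 0 := by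
  have h0 := congrFun heig 0
  have hs : ∀ i : Fin (n + 1), (kout i.succ : ℂ) * v 0 - kin i.succ * v i.succ
      = lam * v i.succ := by
    intro i
    have h := congrFun heig i.succ
    simp [Matrix.mulVec, dotProduct, mammillary, Fin.sum_univ_succ (n := n + 1), apply_ite Complex.ofReal, ite_mul] at h
    linear_combination h
  have h0' : (-(k10 : ℂ) - ∑ i : Fin (n + 1), (kout i.succ : ℂ)) * v 0
      + ∑ i : Fin (n + 1), (kin i.succ : ℂ) * v i.succ = lam * v 0 := by
    simp only [Matrix.mulVec, dotProduct, mammillary, Finset.sum_filter] at h0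
    simp [Fin.sum_univ_succ (n := n + 1)] at h0
    exact h0
  have hb : ∀ i : Fin (n + 1), 0 < kout i.succ := fun i => hkout _ (Fin.succ_ne_zero i)
  have ha : ∀ i : Fin (n + 1), 0 < kin i.succ := fun i => hkin _ (Fin.succ_ne_zero i)
  obtain ⟨S, hS⟩ : ∃ S : ℝ, S = normSq (v 0)
      + ∑ i : Fin (n + 1), kin i.succ / kout i.succ * normSq (v i.succ) := ⟨_, rfl⟩
  obtain ⟨R, hR⟩ : ∃ R : ℝ, R = k10 * normSq (v 0)
      + ∑ i : Fin (n + 1), 1 / kout i.succ *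
        normSq ((kout i.succ : ℂ) * v 0 - kin i.succ * v i.succ) := ⟨_, rfl⟩
  have hterm : ∀ i : Fin (n + 1), ∀ z, z = normSq (v i.succ) →
      0 ≤ kin i.succ / kout i.succ * z := by
    rintro i z rfl
    exact mul_nonneg (div_pos (ha i) (hb i)).le (normSq_nonneg _)
  have hsum : 0 ≤ ∑ i : Fin (n + 1), kin i.succ / kout i.succ * normSq (v i.succ) :=
    Finset.sum_nonneg fun i _ => hterm i _ rfl
  have hSpos : 0 < S := by
    obtain ⟨j, hj⟩ := Function.ne_iff.mp hv
    have hj' : 0 < normSq (v j) := normSq_pos.mpr hj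
    rw [hS]
    rcases Fin.eq_zero_or_eq_succ j with rfl | ⟨i, rfl⟩
    · linarith
    · have h1 := Finset.single_le_sum (f := fun i : Fin (n + 1) =>
        kin i.succ / kout i.succ * normSq (v i.succ))
        (fun i _ => hterm i _ rfl) (Finset.mem_univ i)
      have h2 := mul_pos (div_pos (ha i) (hb i)) hj'
      have h3 := normSq_nonneg (v 0)
      linarith
  have hRnn : 0 ≤ R := by
    rw [hR]
    refine add_nonneg (mul_nonneg hk10.le (normSq_nonneg _)) (Finset.sum_nonneg fun i _ => ?_)
    exact mul_nonneg (one_div_pos.mpr (hb i)).le (normSq_nonneg _)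
  have key : lam * (S : ℂ) = ((-R : ℝ) : ℂ) := by
    have ht : ∀ i : Fin (n + 1),
        lam * ((kin i.succ / kout i.succ * normSq (v i.succ) : ℝ) : ℂ)
        = -((1 / kout i.succ *
            normSq ((kout i.succ : ℂ) * v 0 - kin i.succ * v i.succ) : ℝ) : ℂ)
          + (kout i.succ : ℂ) * (v 0 * (starRingEnd ℂ) (v 0))
          - (kin i.succ * v i.succ) * (starRingEnd ℂ) (v 0) := by
      intro i
      have hne : (kout i.succ : ℂ) ≠ 0 := by exact_mod_cast (hb i).ne'
      push_cast
      rw [← mul_conj, ← mul_conj]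
      simp only [map_sub, map_mul, conj_ofReal]
      field_simp
      linear_combination (-(kin i.succ : ℂ) * (starRingEnd ℂ) (v i.succ)) * hs i
    have hsumt := Finset.sum_congr (rfl : (Finset.univ : Finset (Fin (n + 1))) = _)
      (fun i _ => ht i)
    rw [← Finset.mul_sum, Finset.sum_sub_distrib, Finset.sum_add_distrib,
      ← Finset.sum_mul, ← Finset.sum_mul, Finset.sum_neg_distrib,
      ← ofReal_sum, ← ofReal_sum] at hsumt
    rw [hS, hR, ofReal_neg, ofReal_add, ofReal_add, ofReal_mul k10, ← mul_conj (v 0)]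
    linear_combination hsumt - (starRingEnd ℂ) (v 0) * h0'
  have hre := congrArg Complex.re key
  have him := congrArg Complex.im key
  rw [re_mul_ofReal, ofReal_re] at hre
  rw [im_mul_ofReal, ofReal_im] at him
  constructor
  · exact (mul_eq_zero.mp him).resolve_right hSpos.ne'
  · by_contra hc
    push Not at hc
    have := mul_pos hc hSpos
    linarith
end

section
/- Let α be a monic real polynomial of degree 3 and β a real polynomial. There exists a unique tuple (k_{10}, k_{12}, k_{13}, k_{21}, k_{31}) ∈ ℝ⁵ with k_{21} < k_{31} such that the associated 3×3 mammillary matrix A, with B = (1,0,0)ᵀ and C = (1,0,0), satisfies C · adj(sI − A) · B = β(s) and det(sI − A) = α(s) (as polynomial identities) if and only if β is a monic polynomial of degree 2 whose two roots are real, distinct, and nonzero. -/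
open Polynomial

/-- The 3-compartment mammillary matrix with parameters
`(k10, k12, k13, k21, k31)`. -/
def mam3 (k10 k12 k13 k21 k31 : ℝ) : Matrix (Fin 3) (Fin 3) ℝ :=
  !![-k10 - k12 - k13, k21, k31;
     k12, -k21, 0;
     k13, 0, -k31]

lemma mam3_adj (p q r a b : ℝ) :
    (Matrix.charmatrix (mam3 p q r a b)).adjugate 0 0 = (X + C a) * (X + C b) := by
  rw [Matrix.adjugate_fin_three]
  simp [mam3]

lemma mam3_charpoly (p q r a b : ℝ) :
    (mam3 p q r a b).charpoly = X ^ 3 + C (p + q + r + a + b) * X ^ 2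
      + C ((p + q + r) * (a + b) + a * b - a * q - b * r) * X + C (p * a * b) := by
  rw [Matrix.charpoly, Matrix.det_fin_three]
  simp [mam3]
  ring

lemma cubic_inj (a b c a' b' c' : ℝ)
    (h : (X ^ 3 + C a * X ^ 2 + C b * X + C c : ℝ[X]) = X ^ 3 + C a' * X ^ 2 + C b' * X + C c') :
    a = a' ∧ b = b' ∧ c = c' := by
  have h0 := congrArg (eval 0) h
  have h1 := congrArg (eval 1) h
  have h2 := congrArg (eval (-1)) h
  simp at h0 h1 h2
  refine ⟨by linarith, by linarith, h0⟩

lemma quad_inj (a b c d : ℝ) (hab : a < b) (hcd : c < d)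
    (h : ((X + C a) * (X + C b) : ℝ[X]) = (X + C c) * (X + C d)) : a = c ∧ b = d := by
  have h0 := congrArg (eval 0) h
  have h1 := congrArg (eval 1) h
  simp at h0 h1
  have hs : a + b = c + d := by linarith
  have : (a - c) * (a - d) = 0 := by
    have hb : b = c + d - a := by linarith
    subst hb; linarith
  rcases mul_eq_zero.mp this with h | h
  · constructor <;> linarith
  · exfalso; linarith

theorem mam3_realization_iff
    (α β : Polynomial ℝ) (hα : α.Monic) (hdeg : α.natDegree = 3) :
    (∃! k : ℝ × ℝ × ℝ × ℝ × ℝ,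
        k.2.2.2.1 < k.2.2.2.2 ∧
        (Matrix.charmatrix (mam3 k.1 k.2.1 k.2.2.1 k.2.2.2.1 k.2.2.2.2)).adjugate 0 0
          = β ∧
        (mam3 k.1 k.2.1 k.2.2.1 k.2.2.2.1 k.2.2.2.2).charpoly = α) ↔
      (∃ z₂ z₃ : ℝ, z₃ < z₂ ∧ z₂ ≠ 0 ∧ z₃ ≠ 0 ∧
        β = (X - C z₂) * (X - C z₃)) := by
  simp only [mam3_adj, mam3_charpoly]
  constructor
  · rintro ⟨⟨p, q, r, a, b⟩, ⟨hab, hβ, hc⟩, huniq⟩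
    dsimp only at hab hβ hc huniq
    refine ⟨-a, -b, by linarith, ?_, ?_, ?_⟩
    · intro ha
      have ha : a = 0 := by linarith
      subst ha
      have := huniq (p + 1, q - 1, r, 0, b) ⟨hab, hβ, by
        rw [← hc]; dsimp only; simp only [map_add, map_sub, map_mul, map_one, map_zero]; ring⟩
      have := congrArg Prod.fst this
      simp at this
    · intro hb
      have hb : b = 0 := by linarith
      subst hb
      have := huniq (p + 1, q, r - 1, a, 0) ⟨hab, hβ, by
        rw [← hc]; dsimp only; simp only [map_add, map_sub, map_mul, map_one, map_zero]; ring⟩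
      have := congrArg Prod.fst this
      simp at this
    · rw [← hβ]; simp
  · rintro ⟨z, w, hlt, hz, hw, rfl⟩
    obtain ⟨a, rfl⟩ : ∃ a, z = -a := ⟨-z, by simp⟩
    obtain ⟨b, rfl⟩ : ∃ b, w = -b := ⟨-w, by simp⟩
    have hab : a < b := by linarith
    have ha : a ≠ 0 := by simpa using hz
    have hb : b ≠ 0 := by simpa using hw
    have hba : b - a ≠ 0 := by intro h; linarith
    obtain ⟨c2, c1, c0, hα'⟩ : ∃ c2 c1 c0 : ℝ,
        α = X ^ 3 + C c2 * X ^ 2 + C c1 * X + C c0 := by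
      refine ⟨α.coeff 2, α.coeff 1, α.coeff 0, ?_⟩
      conv_lhs => rw [hα.as_sum, hdeg]
      simp [Finset.sum_range_succ]
      ring
    have e : ((X - C (-a)) * (X - C (-b)) : ℝ[X]) = (X + C a) * (X + C b) := by simp
    rw [e, hα']
    clear hα' hα hdeg
    obtain ⟨p, hp⟩ : ∃ p, p * a * b = c0 := ⟨c0 / (a * b), by field_simp⟩
    obtain ⟨T, hT⟩ : ∃ T, T = c2 - a - b - p := ⟨_, rfl⟩
    obtain ⟨U, hU⟩ : ∃ U, U = (p + T) * (a + b) + a * b - c1 := ⟨_, rfl⟩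
    obtain ⟨q, hq⟩ : ∃ q, q * (b - a) = b * T - U := ⟨(b * T - U) / (b - a), by field_simp⟩
    obtain ⟨r, hr⟩ : ∃ r, r = T - q := ⟨_, rfl⟩
    refine ⟨(p, q, r, a, b), ⟨hab, rfl, ?_⟩, ?_⟩
    · dsimp only
      have h2 : p + q + r + a + b = c2 := by linarith
      have h1 : (p + q + r) * (a + b) + a * b - a * q - b * r = c1 := by
        subst hr; linear_combination hq - hU
      rw [h1, h2, hp]
    · rintro ⟨p', q', r', a', b'⟩ ⟨hab', hβ, hc⟩
      dsimp only at hab' hβ hc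
      obtain ⟨rfl, rfl⟩ := quad_inj _ _ _ _ hab' hab hβ
      obtain ⟨h2, h1, h0⟩ := cubic_inj _ _ _ _ _ _ hc
      have hpp : p' = p := by
        apply mul_right_cancel₀ ha; apply mul_right_cancel₀ hb; linarith
      subst hpp
      have hrr : r' = T - q' := by linarith
      have hqq : q' = q := by
        apply mul_right_cancel₀ hba
        rw [hq, hU]; subst hrr; linear_combination h1
      subst hqq
      rw [hrr, hr]
end

section
/- Let z_2 > z_3 be distinct nonzero real numbers, let β(s) = (s − z_2)(s − z_3), and let α be a monic real polynomial of degree 3. Define k_{21} = −z_2, k_{31} = −z_3, k_{10} = α(0)/(z_2 z_3), k_{12} = α(z_2)/(z_2 (z_2 − z_3)), and k_{13} = −α(z_3)/(z_3 (z_2 − z_3)). Then the 3×3 mammillary matrix A with these parameters, together with B = (1,0,0)ᵀ and C = (1,0,0), satisfies C · adj(sI − A) · B = β(s) and det(sI − A) = α(s) as polynomial identities. -/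
open Polynomial

/-- the explicit parameter formulas realize the transfer function
`β/α` with `β(s) = (s − z₂)(s − z₃)` and `α` monic of degree 3. -/
theorem mam3_realization_formulas
    (α : Polynomial ℝ) (hα : α.Monic) (hdeg : α.natDegree = 3)
    (z₂ z₃ : ℝ) (hz : z₃ < z₂) (hz₂ : z₂ ≠ 0) (hz₃ : z₃ ≠ 0)
    (β : Polynomial ℝ) (hβ : β = (X - C z₂) * (X - C z₃))
    (k10 k12 k13 k21 k31 : ℝ)
    (hk21 : k21 = -z₂) (hk31 : k31 = -z₃)
    (hk10 : k10 = α.eval 0 / (z₂ * z₃))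
    (hk12 : k12 = α.eval z₂ / (z₂ * (z₂ - z₃)))
    (hk13 : k13 = -(α.eval z₃ / (z₃ * (z₂ - z₃)))) :
    (Matrix.charmatrix (mam3 k10 k12 k13 k21 k31)).adjugate 0 0 = β ∧
      (mam3 k10 k12 k13 k21 k31).charpoly = α := by
  have hne : z₂ - z₃ ≠ 0 := sub_ne_zero.mpr hz.ne'
  have hev : ∀ s : ℝ, α.eval s = s ^ 3 + α.coeff 2 * s ^ 2 + α.coeff 1 * s + α.coeff 0 := by
    intro s
    have h3 : α.coeff 3 = 1 := by rw [← hdeg]; exact hα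
    rw [eval_eq_sum_range, hdeg]
    simp only [Finset.sum_range_succ, Finset.sum_range_zero, h3]
    ring
  constructor
  · subst hβ hk21 hk31
    rw [Matrix.adjugate_fin_three]
    simp [Matrix.charmatrix_apply, mam3, Matrix.diagonal]
  · apply Polynomial.funext
    intro s
    have hd : (mam3 k10 k12 k13 k21 k31).charpoly.eval s =
        (s + k10 + k12 + k13) * (s + k21) * (s + k31)
          - k21 * k12 * (s + k31) - k31 * k13 * (s + k21) := by
      rw [Matrix.charpoly, Matrix.det_fin_three]
      simp [Matrix.charmatrix_apply, mam3, Matrix.diagonal]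
      ring
    rw [hd, hev s, hk12, hk13, hk10, hk21, hk31, hev, hev, hev]
    field_simp
    ring
end

section
/- Let n ≥ 2 and let A be the n×n mammillary matrix with real parameters (k_{10}, k_{21},…,k_{n1}, k_{12},…,k_{1n}), and let B = e_1 ∈ ℝⁿ (first standard basis vector) and C = e_1ᵀ. Then, as an identity of real polynomials in s, C · adj(sI − A) · B = ∏_{i=2}^{n} (s + k_{i1}). -/
open Polynomial Finset

/-- with `B = e₁` and `C = e₁ᵀ`, the numerator `C ⬝ adj(sI − A) ⬝ B`,
i.e. the `(0,0)` entry of the adjugate of the characteristic matrix, equals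
`∏_{i=2}^{n} (s + k_{i1})`. -/
theorem mammillary_adjugate_entry
    (n : ℕ) (k10 : ℝ) (kin kout : Fin (n + 2) → ℝ) :
    (Matrix.charmatrix (mammillary n k10 kin kout)).adjugate 0 0 =
      ∏ i ∈ Finset.univ.filter (fun i => i ≠ (0 : Fin (n + 2))), (X + C (kin i)) := by
  have h : (Matrix.charmatrix (mammillary n k10 kin kout)).submatrix
      (Fin.succAbove 0) (Fin.succAbove 0) =
      Matrix.diagonal (fun i : Fin (n + 1) => (X + C (kin i.succ) : ℝ[X])) := by
    ext1 i j
    by_cases hij : i = j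
    · subst hij
      simp [mammillary, Matrix.charmatrix_apply, Fin.succ_ne_zero]
    · simp [mammillary, Matrix.charmatrix_apply, Fin.succ_ne_zero, hij]
  rw [Matrix.adjugate_fin_succ_eq_det_submatrix, h, Matrix.det_diagonal, Finset.prod_filter]
  conv_rhs => rw [Fin.prod_univ_succ]
  simp [Fin.succ_ne_zero]
end

section
/- Let n ≥ 2 and let A be the n×n mammillary matrix with real parameters (k_{10}, k_{21},…,k_{n1}, k_{12},…,k_{1n}). Let χ(s) = det(sI − A) be its characteristic polynomial. Then χ(0) = k_{10} · ∏_{i=2}^{n} k_{i1}. -/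
open Polynomial Finset

/-- the characteristic polynomial `χ(s) = det(sI − A)` of the
mammillary matrix satisfies `χ(0) = k_{10} ∏_{i=2}^{n} k_{i1}`. -/
theorem mammillary_charpoly_eval_zero
    (n : ℕ) (k10 : ℝ) (kin kout : Fin (n + 2) → ℝ) :
    ((mammillary n k10 kin kout).charpoly).eval 0 =
      k10 * ∏ i ∈ Finset.univ.filter (fun i => i ≠ (0 : Fin (n + 2))), kin i := by
  have hf : Finset.univ.filter (fun i => i ≠ (0 : Fin (n + 2)))
      = Finset.univ.map (Fin.succEmb (n + 1)) := by
    ext i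
    refine Fin.cases ?_ (fun i => ?_) i <;> simp [Fin.succ_ne_zero]
  rw [Matrix.eval_charpoly]
  set B := (Matrix.scalar (Fin (n + 2)) (0 : ℝ)) - mammillary n k10 kin kout with hB
  have h := Matrix.det_updateRow_sum B 0 (fun _ => 1)
  simp only [one_smul] at h
  have hrow : (∑ k, B k) = fun j => if j = 0 then k10 else 0 := by
    funext j
    refine (Finset.sum_apply j Finset.univ (fun k l => B k l)).trans ?_
    rw [Fin.sum_univ_succ]
    refine Fin.cases ?_ (fun j => ?_) j
    · simp [hB, mammillary, hf, Fin.succ_ne_zero]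
    · simp [hB, mammillary, Fin.succ_ne_zero, Fin.succ_inj]
  rw [← h, hrow, Matrix.det_of_isLowerTriangular, Fin.prod_univ_succ, hf, Finset.prod_map]
  · simp [hB, mammillary, Matrix.updateRow_apply, Fin.succ_ne_zero]
  · intro i j hij
    have hij' : i < j := by simpa using hij
    have hj : j ≠ 0 := by rintro rfl; simp at hij'
    have hne : i ≠ j := hij'.ne
    by_cases hi : i = 0
    · subst hi
      simp [hj]
    · simp [hB, mammillary, Matrix.updateRow_apply, hi, hj, hne]
end

section
/- Let n ≥ 2 and let A be the n×n mammillary matrix with real parameters (k_{10}, k_{21},…,k_{n1}, k_{12},…,k_{1n}), and let χ(s) = det(sI − A) be its characteristic polynomial. Then for each i ∈ {2,…,n}, χ(−k_{i1}) = k_{1i} · (−k_{i1}) · ∏_{j=2, j≠i}^{n} (k_{j1} − k_{i1}). -/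
open Polynomial Finset

/-- the characteristic polynomial `χ(s) = det(sI − A)` of the
mammillary matrix satisfies, for each peripheral index `i`,
`χ(−k_{i1}) = k_{1i} ⋅ (−k_{i1}) ⋅ ∏_{j ≠ i, j ≠ 1} (k_{j1} − k_{i1})`. -/
theorem mammillary_charpoly_eval_at_minus_kin
    (n : ℕ) (k10 : ℝ) (kin kout : Fin (n + 2) → ℝ)
    (i : Fin (n + 2)) (hi : i ≠ 0) :
    ((mammillary n k10 kin kout).charpoly).eval (-(kin i)) =
      kout i * (-(kin i)) *
        ∏ j ∈ (Finset.univ.filter (fun j => j ≠ (0 : Fin (n + 2)))).erase i,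
          (kin j - kin i) := by
  rw [Matrix.eval_charpoly]
  set M := Matrix.scalar (Fin (n + 2)) (-(kin i)) - mammillary n k10 kin kout with hM
  have e0 : ∀ j, j ≠ 0 → M j 0 = - kout j := by
    intro j hj
    simp [hM, mammillary, Matrix.scalar_apply, Matrix.diagonal_apply, hj]
  have e1 : ∀ j, j ≠ 0 → M 0 j = - kin j := by
    intro j hj
    simp [hM, mammillary, Matrix.scalar_apply, Matrix.diagonal_apply, hj, hj.symm]
  have e2 : ∀ j, j ≠ 0 → M j j = kin j - kin i := by
    intro j hj
    simp [hM, mammillary, Matrix.scalar_apply, hj]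
    ring
  have e3 : ∀ j l, j ≠ 0 → l ≠ 0 → j ≠ l → M j l = 0 := by
    intro j l hj hl hjl
    simp [hM, mammillary, Matrix.scalar_apply, Matrix.diagonal_apply, hj, hl, hjl]
  have e4 : M i i = 0 := by rw [e2 i hi, sub_self]
  clear_value M
  have hS : (Finset.univ.filter (fun j => j ≠ (0 : Fin (n + 2)))) = Finset.univ.erase 0 := by
    ext j; simp
  rw [hS, Matrix.det_apply', Finset.sum_eq_single (Equiv.swap 0 i)]
  · rw [Equiv.Perm.sign_swap hi.symm, ← Finset.mul_prod_erase _ _ (Finset.mem_univ (0 : Fin (n+2))),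
      ← Finset.mul_prod_erase _ _ (Finset.mem_erase.2 ⟨hi, Finset.mem_univ i⟩),
      Equiv.swap_apply_left, Equiv.swap_apply_right, e0 i hi, e1 i hi]
    rw [Finset.prod_congr rfl (g := fun j => kin j - kin i)]
    · push_cast
      ring
    · intro x hx
      simp only [Finset.mem_erase, Finset.mem_univ, and_true] at hx
      rw [Equiv.swap_apply_of_ne_of_ne hx.2 hx.1, e2 x hx.2]
  · intro σ _ hσ
    by_contra hne
    have hp : ∀ x, M (σ x) x ≠ 0 := by
      intro x hx
      exact hne (by rw [Finset.prod_eq_zero (f := fun y => M (σ y) y) (Finset.mem_univ x) hx, mul_zero])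
    have h1 : σ i = 0 := by
      by_contra h
      apply hp i
      by_cases h' : σ i = i
      · rw [h', e4]
      · exact e3 _ _ h hi h'
    have h3 : ∀ x, x ≠ 0 → x ≠ i → σ x = x := by
      intro x hx hxi
      by_contra h
      exact hp x (e3 _ _ (fun h0 => hxi (σ.injective (h0.trans h1.symm))) hx h)
    have h2 : σ 0 = i := by
      obtain ⟨y, hy⟩ := σ.surjective i
      by_cases hy0 : y = 0
      · rw [← hy0, hy]
      · by_cases hyi : y = i
        · rw [hyi, h1] at hy
          exact absurd hy.symm hi
        · rw [h3 y hy0 hyi] at hy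
          exact absurd hy hyi
    apply hσ
    ext x
    by_cases hx : x = 0
    · rw [hx, h2, Equiv.swap_apply_left]
    · by_cases hxi : x = i
      · rw [hxi, h1, Equiv.swap_apply_right]
      · rw [h3 x hx hxi, Equiv.swap_apply_of_ne_of_ne hx hxi]
  · intro h
    exact absurd (Finset.mem_univ _) h
end

section
/- Let n ≥ 2, let α be a monic real polynomial of degree n and β a real polynomial. There exists a unique parameter vector p = (k_{10}, k_{21},…,k_{n1}, k_{12},…,k_{1n}) ∈ ℝ^{2n−1} with k_{21} < k_{31} < ⋯ < k_{n1} such that the associated n×n mammillary matrix A_p, with B = e_1 and C = e_1ᵀ, satisfies C · adj(sI − A_p) · B = β(s) and det(sI − A_p) = α(s) (as polynomial identities) if and only if β is a monic polynomial of degree n−1 having n−1 pairwise distinct real nonzero roots. -/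
open Polynomial Finset

lemma arrow_det {R : Type*} [CommRing R] [IsDomain R] (m : ℕ)
    (M : Matrix (Fin (m + 1)) (Fin (m + 1)) R)
    (h : ∀ i j : Fin m, i ≠ j → M i.succ j.succ = 0)
    (hd : ∀ i : Fin m, M i.succ i.succ ≠ 0) :
    M.det = M 0 0 * ∏ i : Fin m, M i.succ i.succ
      - ∑ i : Fin m, M 0 i.succ * M i.succ 0 * ∏ j ∈ univ.erase i, M j.succ j.succ := by
  set P := ∏ i : Fin m, M i.succ i.succ with hP
  have hP0 : P ≠ 0 := Finset.prod_ne_zero_iff.2 fun i _ => hd i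
  let N : Matrix (Fin (m + 1)) (Fin (m + 1)) R := Matrix.of fun i j =>
    Fin.cases (Fin.cases P (fun i => - (M i.succ 0 * ∏ j ∈ univ.erase i, M j.succ j.succ)) i)
      (fun j => if i = j.succ then 1 else 0) j
  have N00 : N 0 0 = P := rfl
  have Ns0 : ∀ i : Fin m, N i.succ 0 = - (M i.succ 0 * ∏ j ∈ univ.erase i, M j.succ j.succ) :=
    fun i => rfl
  have Nis : ∀ i (j : Fin m), N i j.succ = if i = j.succ then 1 else 0 := fun i j => rfl
  have hN : N.det = P := by
    rw [Matrix.det_of_lowerTriangular]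
    · rw [Fin.prod_univ_succ, N00]
      simp [Nis]
    · intro i j hij
      have hij' : i < j := hij
      induction j using Fin.cases with
      | zero => exact absurd hij' (Fin.not_lt_zero _)
      | succ j => rw [Nis, if_neg hij'.ne]
  have hMN : ∀ i (j : Fin m), (M * N) i j.succ = M i j.succ := by
    intro i j
    rw [Matrix.mul_apply]
    simp [Nis]
  have hMN0 : ∀ i : Fin m, (M * N) i.succ 0 = 0 := by
    intro i
    rw [Matrix.mul_apply, Fin.sum_univ_succ, N00, Finset.sum_eq_single i]
    · rw [Ns0, hP, ← Finset.mul_prod_erase univ _ (mem_univ i)]; ring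
    · intro b _ hb
      rw [h i b hb.symm, zero_mul]
    · simp
  have hT : (M * N).det = (M * N) 0 0 * P := by
    rw [Matrix.det_of_upperTriangular]
    · rw [Fin.prod_univ_succ]
      simp [hMN, hP]
    · intro i j hij
      have hij' : j < i := hij
      induction i using Fin.cases with
      | zero => exact absurd hij' (Fin.not_lt_zero _)
      | succ i =>
        induction j using Fin.cases with
        | zero => exact hMN0 i
        | succ j => rw [hMN]; exact h _ _ (fun e => hij'.ne (by rw [e]))
  rw [Matrix.det_mul, hN] at hT
  rw [mul_right_cancel₀ hP0 hT, Matrix.mul_apply, Fin.sum_univ_succ, N00, sub_eq_add_neg,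
    ← Finset.sum_neg_distrib]
  congr 1
  refine Finset.sum_congr rfl fun i _ => ?_
  rw [Ns0]; ring

lemma sum_ne_zero_fin (n : ℕ) (f : Fin (n + 2) → ℝ) :
    ∑ l ∈ Finset.univ.filter (fun l => l ≠ (0 : Fin (n + 2))), f l = ∑ i : Fin (n + 1), f i.succ := by
  rw [Finset.sum_filter, Fin.sum_univ_succ]; simp

lemma prod_ne_zero_fin (n : ℕ) (f : Fin (n + 2) → ℝ[X]) :
    ∏ l ∈ Finset.univ.filter (fun l => l ≠ (0 : Fin (n + 2))), f l = ∏ i : Fin (n + 1), f i.succ := by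
  rw [Finset.prod_filter, Fin.prod_univ_succ]; simp

lemma mam_adj (n : ℕ) (k : ℝ) (a b : Fin (n + 2) → ℝ) :
    (Matrix.charmatrix (mammillary n k a b)).adjugate 0 0
      = ∏ i : Fin (n + 1), (X + C (a i.succ)) := by
  rw [Matrix.adjugate_fin_succ_eq_det_submatrix]
  have : (Matrix.charmatrix (mammillary n k a b)).submatrix (Fin.succAbove 0) (Fin.succAbove 0)
      = Matrix.diagonal fun i : Fin (n + 1) => (X + C (a i.succ)) := by
    ext1 i j
    by_cases hij : i = j
    · subst hij
      simp [Matrix.charmatrix_apply, mammillary]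
    · simp [Matrix.charmatrix_apply, mammillary, hij, Matrix.diagonal_apply_ne]
  rw [this, Matrix.det_diagonal]; simp

lemma mam_char (n : ℕ) (k : ℝ) (a b : Fin (n + 2) → ℝ) :
    (mammillary n k a b).charpoly
      = (X + C (k + ∑ i : Fin (n + 1), b i.succ)) * ∏ i : Fin (n + 1), (X + C (a i.succ))
        - ∑ i : Fin (n + 1), C (a i.succ * b i.succ) * ∏ j ∈ univ.erase i, (X + C (a j.succ)) := by
  have e1 : ∀ i : Fin (n + 1), (Matrix.charmatrix (mammillary n k a b)) i.succ i.succ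
      = X + C (a i.succ) := by
    intro i; simp [Matrix.charmatrix_apply, mammillary]
  rw [Matrix.charpoly, arrow_det]
  · simp only [e1]
    congr 1
    · congr 1
      simp only [Matrix.charmatrix_apply, mammillary, sum_ne_zero_fin, Matrix.diagonal_apply_eq,
        Matrix.of_apply, if_true, C_sub, C_neg, C_add]
      ring
    · refine Finset.sum_congr rfl fun i _ => ?_
      congr 1
      have h0 : (0 : Fin (n + 2)) ≠ i.succ := (Fin.succ_ne_zero i).symm
      simp [Matrix.charmatrix_apply, mammillary, h0]
  · intro i j hij
    simp [Matrix.charmatrix_apply, mammillary, hij]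
  · intro i; rw [e1]; exact X_add_C_ne_zero _

lemma eval_S (m : ℕ) (a g : Fin m → ℝ) (k : Fin m) :
    (∑ i : Fin m, C (g i) * ∏ j ∈ univ.erase i, (X + C (a j))).eval (-a k)
      = g k * ∏ j ∈ univ.erase k, (a j - a k) := by
  rw [eval_finsetSum, Finset.sum_eq_single k]
  · simp only [eval_mul, eval_C, eval_prod, eval_add, eval_X]
    congr 1
    exact Finset.prod_congr rfl fun j _ => by ring
  · intro i _ hi
    rw [eval_mul, eval_prod, Finset.prod_eq_zero (i := k)]
    · simp
    · simp [hi.symm]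
    · simp
  · simp

lemma eval_P (m : ℕ) (a : Fin m → ℝ) (k : Fin m) :
    (∏ i : Fin m, (X + C (a i))).eval (-a k) = 0 := by
  rw [eval_prod, Finset.prod_eq_zero (mem_univ k)]; simp

lemma prod_diff_ne (m : ℕ) (a : Fin m → ℝ) (ha : Function.Injective a) (k : Fin m) :
    ∏ j ∈ univ.erase k, (a j - a k) ≠ 0 := by
  rw [Finset.prod_ne_zero_iff]
  intro j hj
  rw [sub_ne_zero]
  exact fun h => (Finset.ne_of_mem_erase hj) (ha h)

lemma monic_P (m : ℕ) (a : Fin m → ℝ) : (∏ i : Fin m, (X + C (a i))).Monic :=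
  monic_prod_of_monic _ _ fun i _ => monic_X_add_C _

lemma natDegree_P (m : ℕ) (a : Fin m → ℝ) : (∏ i : Fin m, (X + C (a i))).natDegree = m := by
  rw [natDegree_prod_of_monic _ _ fun i _ => monic_X_add_C _]; simp

lemma exists_c_b (n : ℕ) (α : ℝ[X]) (hα : α.Monic) (hdeg : α.natDegree = n + 2)
    (a : Fin (n + 1) → ℝ) (ha : Function.Injective a) (h0 : ∀ i, a i ≠ 0) :
    ∃ (c : ℝ) (b : Fin (n + 1) → ℝ),
      (X + C c) * ∏ i, (X + C (a i))
        - ∑ i, C (a i * b i) * ∏ j ∈ univ.erase i, (X + C (a j)) = α := by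
  set P := ∏ i, (X + C (a i)) with hP
  have hPm : P.Monic := monic_P _ a
  have hPd : P.natDegree = n + 1 := natDegree_P _ a
  have hPd' : P.degree = ((n + 1 : ℕ) : WithBot ℕ) := by
    rw [degree_eq_natDegree hPm.ne_zero, hPd]
  have hq1 : (α /ₘ P).natDegree = 1 := by rw [natDegree_divByMonic _ hPm, hdeg, hPd]; omega
  have hqm : (α /ₘ P).Monic := by
    unfold Polynomial.Monic
    rw [leadingCoeff_divByMonic_of_monic hPm]
    · exact hα
    · rw [hPd', degree_eq_natDegree hα.ne_zero, hdeg]; exact_mod_cast (by omega)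
  have hq := hqm.eq_X_add_C hq1
  set r := α %ₘ P with hr
  have hdiv : r + P * (α /ₘ P) = α := modByMonic_add_div α P
  refine ⟨(α /ₘ P).coeff 0,
    fun i => - r.eval (-a i) / (a i * ∏ j ∈ univ.erase i, (a j - a i)), ?_⟩
  rw [← hq]
  suffices hs : -(∑ i, C (a i * (- r.eval (-a i) / (a i * ∏ j ∈ univ.erase i, (a j - a i))))
      * ∏ j ∈ univ.erase i, (X + C (a j))) = r by
    rw [sub_eq_add_neg, hs, mul_comm, add_comm]; exact hdiv
  refine Polynomial.eq_of_degrees_lt_of_eval_index_eq (s := univ) (v := fun i => - a i) ?_ ?_ ?_ ?_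
  · intro x _ y _ hxy; exact ha (neg_injective hxy)
  · rw [degree_neg]
    refine (degree_sum_le _ _).trans_lt ?_
    rw [Finset.sup_lt_iff (by simp)]
    intro i _
    refine (degree_mul_le _ _).trans_lt ?_
    refine (add_le_add_left degree_C_le _).trans_lt ?_
    rw [zero_add]
    rw [degree_prod]
    simp only [degree_X_add_C, sum_const, card_erase_of_mem (mem_univ i), card_univ, Fintype.card_fin]
    simp
    exact_mod_cast Nat.lt_succ_self n
  · rw [card_univ, Fintype.card_fin, ← hPd']
    exact degree_modByMonic_lt _ hPm
  · intro i _
    rw [eval_neg, eval_S _ a (fun i => a i * (- r.eval (-a i) / (a i * ∏ j ∈ univ.erase i, (a j - a i))))]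
    have := prod_diff_ne _ a ha i
    have := h0 i
    field_simp

lemma unique_c_b (m : ℕ) (a : Fin m → ℝ) (ha : Function.Injective a) (h0 : ∀ i, a i ≠ 0)
    (c c' : ℝ) (b b' : Fin m → ℝ)
    (h : (X + C c) * ∏ i, (X + C (a i))
        - ∑ i, C (a i * b i) * ∏ j ∈ univ.erase i, (X + C (a j))
      = (X + C c') * ∏ i, (X + C (a i))
        - ∑ i, C (a i * b' i) * ∏ j ∈ univ.erase i, (X + C (a j))) :
    c = c' ∧ b = b' := by
  have hb : b = b' := by
    funext k
    have := congrArg (eval (-a k)) h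
    rw [eval_sub, eval_sub, eval_mul, eval_mul, eval_P, eval_S _ a (fun i => a i * b i),
      eval_S _ a (fun i => a i * b' i)] at this
    have h1 := prod_diff_ne _ a ha k
    simp only [mul_zero, zero_sub, neg_inj] at this
    exact mul_left_cancel₀ (h0 k) (mul_right_cancel₀ h1 this)
  refine ⟨?_, hb⟩
  subst hb
  have := mul_right_cancel₀ (monic_P m a).ne_zero (sub_left_injective h)
  exact C_injective (add_left_cancel this)

/-- the transfer function `β/α` (with `α` monic of degree `n`) admits a
unique realization by an `n`-compartment mammillary model (parameter vector
`p = (k10, kin, kout)` normalized by `kin 0 = kout 0 = 0` — so that `p` has exactly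
`2n − 1` meaningful entries — and ordered by `k_{21} < k_{31} < ⋯ < k_{n1}`) iff `β`
is a monic polynomial of degree `n − 1` with `n − 1` pairwise distinct real nonzero
roots. -/
theorem mammillary_realization_iff
    (n : ℕ) (α β : Polynomial ℝ) (hα : α.Monic) (hdeg : α.natDegree = n + 2) :
    (∃! p : ℝ × (Fin (n + 2) → ℝ) × (Fin (n + 2) → ℝ),
        p.2.1 0 = 0 ∧ p.2.2 0 = 0 ∧
        (∀ i j : Fin (n + 2), 0 < i → i < j → p.2.1 i < p.2.1 j) ∧
        (Matrix.charmatrix (mammillary n p.1 p.2.1 p.2.2)).adjugate 0 0 = β ∧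
        (mammillary n p.1 p.2.1 p.2.2).charpoly = α) ↔
      (∃ z : Fin (n + 2) → ℝ,
        (∀ i : Fin (n + 2), i ≠ 0 → z i ≠ 0) ∧
        Set.InjOn z {i : Fin (n + 2) | i ≠ 0} ∧
        β = ∏ i ∈ Finset.univ.filter (fun i => i ≠ (0 : Fin (n + 2))),
          (X - C (z i))) := by
  constructor
  · rintro ⟨⟨k, a, b⟩, ⟨ha0, hb0, hmono, hadj, hchar⟩, huniq⟩
    dsimp only at ha0 hb0 hmono hadj hchar
    refine ⟨fun i => - a i, ?_, ?_, ?_⟩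
    · intro i hi hai
      have hai' : a i = 0 := neg_eq_zero.1 hai
      obtain ⟨t, rfl⟩ := Fin.exists_succ_eq.2 hi
      have := huniq (k - 1, a, Function.update b t.succ (b t.succ + 1)) ⟨ha0, ?_, hmono, ?_, ?_⟩
      · have := congrArg Prod.fst this
        simp at this
      · simpa [Function.update_of_ne (Fin.succ_ne_zero t).symm] using hb0
      · rw [← hadj, mam_adj, mam_adj]
      · rw [← hchar, mam_char, mam_char]
        have hsum : k - 1 + ∑ i : Fin (n + 1), Function.update b t.succ (b t.succ + 1) i.succ
            = k + ∑ i : Fin (n + 1), b i.succ := by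
          have : ∀ i : Fin (n + 1), Function.update b t.succ (b t.succ + 1) i.succ
              = b i.succ + if i = t then 1 else 0 := by
            intro i
            by_cases h : i = t
            · subst h; simp
            · simp [Function.update_apply, h]
          simp only [this, sum_add_distrib]
          simp
        dsimp only
        rw [hsum]
        congr 1
        refine Finset.sum_congr rfl fun i _ => ?_
        by_cases h : i = t
        · subst h; simp [hai']
        · simp [Function.update_apply, h]
    · intro i hi j hj hij
      have hij' : a i = a j := neg_injective hij
      rcases lt_trichotomy i j with h | h | h
      · exact absurd hij' (hmono i j (Fin.pos_iff_ne_zero.2 hi) h).ne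
      · exact h
      · exact absurd hij' (hmono j i (Fin.pos_iff_ne_zero.2 hj) h).ne'
    · rw [← hadj, mam_adj, prod_ne_zero_fin]
      simp
  · rintro ⟨z, hz0, hinj, rfl⟩
    rw [prod_ne_zero_fin]
    have hwinj : Function.Injective (fun i : Fin (n + 1) => - z i.succ) := by
      intro i j hij
      exact Fin.succ_injective _ (hinj (Fin.succ_ne_zero i) (Fin.succ_ne_zero j) (neg_injective hij))
    set S : Finset ℝ := univ.image (fun i : Fin (n + 1) => - z i.succ) with hS
    have hcard : S.card = n + 1 := by
      rw [hS, card_image_of_injective _ hwinj]; simp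
    set a : Fin (n + 1) → ℝ := fun i => S.orderEmbOfFin hcard i with ha
    have hamono : StrictMono a := (S.orderEmbOfFin hcard).strictMono
    have hPS : ∏ i : Fin (n + 1), (X - C (z i.succ)) = ∏ x ∈ S, (X + C x) := by
      rw [hS, prod_image (fun x _ y _ h => hwinj h)]
      simp [sub_eq_add_neg]
    have hPa : ∏ i : Fin (n + 1), (X + C (a i)) = ∏ x ∈ S, (X + C x) := by
      rw [← Finset.image_orderEmbOfFin_univ S hcard,
        prod_image (fun x _ y _ h => (S.orderEmbOfFin hcard).injective h)]
    have ha0 : ∀ i, a i ≠ 0 := by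
      intro i h
      have : a i ∈ S := S.orderEmbOfFin_mem hcard i
      rw [hS, mem_image] at this
      obtain ⟨j, _, hj⟩ := this
      rw [h] at hj
      exact hz0 _ (Fin.succ_ne_zero j) (neg_eq_zero.1 hj)
    obtain ⟨c, b, hcb⟩ := exists_c_b n α hα hdeg a hamono.injective ha0
    refine ⟨(c - ∑ i, b i, Fin.cons 0 a, Fin.cons 0 b), ⟨rfl, rfl, ?_, ?_, ?_⟩, ?_⟩
    · intro i j hi hij
      obtain ⟨i, rfl⟩ := Fin.exists_succ_eq.2 hi.ne'
      obtain ⟨j, rfl⟩ := Fin.exists_succ_eq.2 (hi.trans hij).ne'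
      exact hamono (Fin.succ_lt_succ_iff.1 hij)
    · rw [mam_adj, hPS, ← hPa]; rfl
    · rw [mam_char]
      simp only [Fin.cons_succ, sub_add_cancel]
      exact hcb
    · rintro ⟨k', a', b'⟩ ⟨ha0', hb0', hmono', hadj', hchar'⟩
      dsimp only at ha0' hb0' hmono' hadj' hchar'
      rw [mam_adj, hPS] at hadj'
      have haa : (fun i : Fin (n + 1) => a' i.succ) = a := by
        refine Finset.orderEmbOfFin_unique hcard ?_ ?_
        · intro i
          have h := eval_P _ (fun i : Fin (n + 1) => a' i.succ) i
          rw [hadj', eval_prod, prod_eq_zero_iff] at h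
          obtain ⟨x, hx, hx'⟩ := h
          simp only [eval_add, eval_X, eval_C] at hx'
          have : a' i.succ = x := by linarith
          rw [this]; exact hx
        · intro i j hij
          exact hmono' _ _ (Fin.succ_pos i) (Fin.succ_lt_succ_iff.2 hij)
      have haa' : ∀ i : Fin (n + 1), a' i.succ = a i := fun i => congrFun haa i
      rw [mam_char] at hchar'
      simp only [haa'] at hchar'
      obtain ⟨h1, h2⟩ := unique_c_b _ a hamono.injective ha0 _ _ (fun i => b' i.succ) b
        (hchar'.trans hcb.symm)
      have h2' : ∀ i : Fin (n + 1), b' i.succ = b i := fun i => congrFun h2 i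
      refine Prod.ext ?_ (Prod.ext ?_ ?_)
      · simp only [h2'] at h1
        exact eq_sub_of_add_eq h1
      · funext i
        induction i using Fin.cases with
        | zero => exact ha0'
        | succ i => exact haa' i
      · funext i
        induction i using Fin.cases with
        | zero => exact hb0'
        | succ i => exact h2' i
end
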